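/- arXiv:2302.03415 — 3 statements merged into one kernel-verified Lean document; each statement's English description precedes it below -/
import Mathlib

section
/- Let p be the Gaussian density on ℝⁿ with mean μ and covariance Σ, let A be an n×n real matrix, b ∈ ℝⁿ, and let D be a diagonal n×n real matrix with positive diagonal entries D_ii. Setting μ̇ := Aμ + b, the entropy flow integral satisfies ∑_{i=1}^n (1/D_ii) ∫_{ℝⁿ} p(x) · ((Ax+b)_i + D_ii·(Σ⁻¹(x−μ))_i) · (Ax+b)_i dx = μ̇ᵀD⁻¹μ̇ + Tr(AᵀD⁻¹AΣ) + Tr(A). -/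
open Matrix MeasureTheory Real

/-- The Gaussian probability density on `ℝⁿ` with mean `μ` and covariance matrix `V`. -/
noncomputable def gaussianPDF {n : ℕ} (μ : Fin n → ℝ) (V : Matrix (Fin n) (Fin n) ℝ)
    (x : Fin n → ℝ) : ℝ :=
  (Real.sqrt ((2 * Real.pi) ^ n * V.det))⁻¹ *
    Real.exp (-(1 / 2) * ((x - μ) ⬝ᵥ (V⁻¹ *ᵥ (x - μ))))

/-- Standard one-dimensional Gaussian weight. -/
noncomputable def gw (t : ℝ) : ℝ := ProbabilityTheory.gaussianPDFReal 0 1 t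

lemma gw_eq (t : ℝ) : gw t = (√(2 * π))⁻¹ * Real.exp (-(1 / 2) * (t * t)) := by
  simp only [gw, ProbabilityTheory.gaussianPDFReal, NNReal.coe_one, mul_one, sub_zero]
  rw [show -t ^ 2 / 2 = -(1 / 2) * (t * t) by ring]

lemma gw_int (k : ℕ) : Integrable (fun t : ℝ => gw t * t ^ k) := by
  have h := integrable_rpow_mul_exp_neg_mul_sq (b := 1 / 2) (by norm_num) (s := k)
    (by have : (0 : ℝ) ≤ k := Nat.cast_nonneg k
        linarith)
  refine (h.const_mul ((√(2 * π))⁻¹)).congr (Filter.Eventually.of_forall fun t => ?_)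
  simp only [gw_eq, Real.rpow_natCast]
  rw [show -(1 / 2) * t ^ 2 = -(1 / 2) * (t * t) by ring]
  ring

lemma gw_m0 : ∫ t : ℝ, gw t * t ^ 0 = 1 := by
  simpa [gw] using ProbabilityTheory.integral_gaussianPDFReal_eq_one 0 (v := 1) one_ne_zero

lemma gw_m1 : ∫ t : ℝ, gw t * t ^ 1 = 0 := by
  have h := ProbabilityTheory.integral_id_gaussianReal (μ := 0) (v := 1)
  rw [ProbabilityTheory.integral_gaussianReal_eq_integral_smul one_ne_zero] at h
  simpa [gw] using h

lemma gw_m2 : ∫ t : ℝ, gw t * t ^ 2 = 1 := by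
  have h := ProbabilityTheory.variance_id_gaussianReal (μ := 0) (v := 1)
  rw [ProbabilityTheory.variance_of_integral_eq_zero (by fun_prop)
    (by simp),
    ProbabilityTheory.integral_gaussianReal_eq_integral_smul one_ne_zero] at h
  simpa [gw] using h

lemma mom_int {n : ℕ} (a : Fin n → ℕ) :
    Integrable (fun y : Fin n → ℝ => ∏ k, (gw (y k) * y k ^ a k)) :=
  Integrable.fintype_prod (f := fun k t => gw t * t ^ a k) (fun k => gw_int _)

lemma mom_eq {n : ℕ} (a : Fin n → ℕ) :
    ∫ y : Fin n → ℝ, ∏ k, (gw (y k) * y k ^ a k) = ∏ k, ∫ t : ℝ, gw t * t ^ a k :=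
  integral_fintype_prod_volume_eq_prod (fun k t => gw t * t ^ a k)

lemma prod_single {n : ℕ} (y : Fin n → ℝ) (i : Fin n) :
    ∏ k, y k ^ (Pi.single i 1 : Fin n → ℕ) k = y i := by
  rw [Finset.prod_eq_single i]
  · simp
  · intro k _ hk
    simp [hk]
  · simp

lemma w0 {n : ℕ} : Integrable (fun y : Fin n → ℝ => ∏ k, gw (y k)) ∧
    ∫ y : Fin n → ℝ, ∏ k, gw (y k) = 1 := by
  have h1 := mom_int (n := n) 0
  have h2 := mom_eq (n := n) 0
  simp only [Pi.zero_apply, gw_m0, Finset.prod_const_one] at h1 h2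
  simp only [pow_zero, mul_one] at h1 h2
  exact ⟨h1, h2⟩

lemma w1 {n : ℕ} (i : Fin n) : Integrable (fun y : Fin n → ℝ => (∏ k, gw (y k)) * y i) ∧
    ∫ y : Fin n → ℝ, (∏ k, gw (y k)) * y i = 0 := by
  have h1 := mom_int (n := n) (Pi.single i 1)
  have h2 := mom_eq (n := n) (Pi.single i 1)
  simp only [Finset.prod_mul_distrib, prod_single] at h1 h2
  refine ⟨h1, h2.trans (Finset.prod_eq_zero (Finset.mem_univ i) ?_)⟩
  rw [Pi.single_eq_same, gw_m1]

lemma w2 {n : ℕ} (i j : Fin n) :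
    Integrable (fun y : Fin n → ℝ => (∏ k, gw (y k)) * (y i * y j)) ∧
    ∫ y : Fin n → ℝ, (∏ k, gw (y k)) * (y i * y j) = if i = j then 1 else 0 := by
  have h1 := mom_int (n := n) (Pi.single i 1 + Pi.single j 1)
  have h2 := mom_eq (n := n) (Pi.single i 1 + Pi.single j 1)
  simp only [Pi.add_apply, pow_add, Finset.prod_mul_distrib, prod_single] at h1
  conv_lhs at h2 => simp only [Pi.add_apply, pow_add, Finset.prod_mul_distrib, prod_single]
  refine ⟨h1, h2.trans ?_⟩
  split_ifs with hij
  · subst hij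
    refine Finset.prod_eq_one fun k _ => ?_
    by_cases hk : k = i
    · subst hk
      simpa using gw_m2
    · simpa [Pi.single_apply, hk] using gw_m0
  · refine Finset.prod_eq_zero (Finset.mem_univ i) ?_
    simpa [Pi.single_apply, hij] using gw_m1

lemma quad {n : ℕ} (m m' : ℝ) (c c' : Fin n → ℝ) :
    ∫ y : Fin n → ℝ, (∏ k, gw (y k)) * ((m + c ⬝ᵥ y) * (m' + c' ⬝ᵥ y)) =
      m * m' + c ⬝ᵥ c' := by
  have e : ∀ y : Fin n → ℝ, (∏ k, gw (y k)) * ((m + c ⬝ᵥ y) * (m' + c' ⬝ᵥ y)) =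
      (m * m') * (∏ k, gw (y k)) + ∑ i, (m * c' i + m' * c i) * ((∏ k, gw (y k)) * y i)
       + ∑ i, ∑ j, (c i * c' j) * ((∏ k, gw (y k)) * (y i * y j)) := by
    intro y
    generalize (∏ k, gw (y k)) = p
    have e1 : ∑ i, (m * c' i + m' * c i) * (p * y i)
        = p * (m * (c' ⬝ᵥ y) + m' * (c ⬝ᵥ y)) := by
      simp only [dotProduct, Finset.mul_sum, ← Finset.sum_add_distrib]
      exact Finset.sum_congr rfl fun i _ => by ring
    have e2 : ∑ i, ∑ j, (c i * c' j) * (p * (y i * y j)) = p * ((c ⬝ᵥ y) * (c' ⬝ᵥ y)) := by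
      rw [dotProduct, dotProduct, Finset.sum_mul_sum]
      simp only [Finset.mul_sum]
      exact Finset.sum_congr rfl fun i _ => Finset.sum_congr rfl fun j _ => by ring
    rw [e1, e2]
    ring
  simp_rw [e]
  have i0 := (w0 (n := n)).1.const_mul (m * m')
  have i1 := fun i : Fin n => (w1 i).1.const_mul (m * c' i + m' * c i)
  have i2 := fun i j : Fin n => (w2 i j).1.const_mul (c i * c' j)
  have i1' := integrable_finsetSum Finset.univ fun i _ => i1 i
  have i2' := fun i => integrable_finsetSum Finset.univ fun j _ => i2 i j
  have i01 : Integrable (fun y : Fin n → ℝ => (m * m') * (∏ k, gw (y k)) +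
      ∑ i, (m * c' i + m' * c i) * ((∏ k, gw (y k)) * y i)) := i0.add i1'
  rw [integral_add i01 (integrable_finsetSum Finset.univ fun i _ => i2' i),
    integral_add i0 i1', integral_finsetSum _ (fun i _ => i1 i),
    integral_finsetSum _ (fun i _ => i2' i)]
  simp_rw [integral_finsetSum _ (fun j _ => i2 _ j), integral_const_mul, w0.2, (w1 _).2, (w2 _ _).2]
  simp [dotProduct]

lemma exists_factor {n : ℕ} {V : Matrix (Fin n) (Fin n) ℝ} (hV : V.PosDef) :
    ∃ B : Matrix (Fin n) (Fin n) ℝ, V = B * Bᵀ ∧ B.det ≠ 0 := by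
  obtain ⟨C, hC⟩ : ∃ C : Matrix (Fin n) (Fin n) ℝ, V = star C * C := by
    open scoped MatrixOrder in
    exact CStarAlgebra.nonneg_iff_eq_star_mul_self.mp hV.posSemidef.nonneg
  rw [star_eq_conjTranspose, conjTranspose_eq_transpose_of_trivial] at hC
  refine ⟨Cᵀ, by simpa using hC, fun h => ?_⟩
  have := hV.det_pos
  rw [hC, det_mul, h] at this
  simp at this

lemma change_var {n : ℕ} (B : Matrix (Fin n) (Fin n) ℝ) (hB : B.det ≠ 0) (μ : Fin n → ℝ)
    (F : (Fin n → ℝ) → ℝ) (hF : Continuous F) :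
    ∫ x, F x = ∫ y, |B.det| * F (B *ᵥ y + μ) := by
  have h := Real.map_matrix_volume_pi_eq_smul_volume_pi hB
  have hG : Continuous fun x => F (x + μ) := by fun_prop
  have h3 : ∫ x, F (x + μ) ∂(Measure.map (toLin' B) volume) = ∫ y, F (B *ᵥ y + μ) := by
    rw [integral_map (toLin' B).continuous_of_finiteDimensional.aemeasurable
      hG.aestronglyMeasurable]
    rfl
  rw [h, integral_smul_measure, integral_add_right_eq_self, ENNReal.toReal_ofReal (abs_nonneg _),
    abs_inv, smul_eq_mul] at h3
  rw [integral_const_mul, ← h3, mul_inv_cancel_left₀ (abs_ne_zero.mpr hB)]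

lemma inv_B {n : ℕ} {B V : Matrix (Fin n) (Fin n) ℝ} (hV : V = B * Bᵀ) (hB : B.det ≠ 0) :
    V⁻¹ * B = (B⁻¹)ᵀ := by
  have hu : IsUnit B.det := isUnit_iff_ne_zero.mpr hB
  rw [hV, Matrix.mul_inv_rev, Matrix.mul_assoc, nonsing_inv_mul _ hu, Matrix.mul_one,
    transpose_nonsing_inv]

lemma pdf_change {n : ℕ} {B V : Matrix (Fin n) (Fin n) ℝ} (hV : V = B * Bᵀ) (hB : B.det ≠ 0)
    (μ y : Fin n → ℝ) : |B.det| * gaussianPDF μ V (B *ᵥ y + μ) = ∏ k, gw (y k) := by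
  have hu : IsUnit B.det := isUnit_iff_ne_zero.mpr hB
  have hq : (B *ᵥ y) ⬝ᵥ (V⁻¹ *ᵥ (B *ᵥ y)) = ∑ k, y k * y k := by
    rw [mulVec_mulVec, inv_B hV hB, mulVec_transpose, dotProduct_comm, ← dotProduct_mulVec,
      mulVec_mulVec, nonsing_inv_mul _ hu, one_mulVec]
    rfl
  have hs : √((2 * π) ^ n * V.det) = √(2 * π) ^ n * |B.det| := by
    rw [hV, det_mul, det_transpose, Real.sqrt_mul (by positivity), Real.sqrt_mul_self_eq_abs]
    congr 1
    rw [show (2 * π) ^ n = (√(2 * π) ^ n) ^ 2 by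
      rw [← pow_mul, mul_comm n 2, pow_mul, Real.sq_sqrt (by positivity)]]
    exact Real.sqrt_sq (by positivity)
  simp only [gw_eq, gaussianPDF, add_sub_cancel_right]
  rw [hq, hs, Finset.prod_mul_distrib, ← Real.exp_sum, ← Finset.mul_sum]
  have := abs_ne_zero.mpr hB
  simp only [Finset.prod_const, Finset.card_univ, Fintype.card_fin, inv_pow]
  field_simp

lemma gaussianPDF_cont {n : ℕ} (μ : Fin n → ℝ) (V : Matrix (Fin n) (Fin n) ℝ) :
    Continuous (gaussianPDF μ V) := by
  unfold gaussianPDF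
  simp only [dotProduct, mulVec]
  fun_prop


/-- entropy flow of a linear Gaussian process,
`Φ = ∑ᵢ (1/Dᵢᵢ) ∫ p·(Jᵢ/p)·fᵢ = μ̇ᵀD⁻¹μ̇ + Tr(AᵀD⁻¹AΣ) + Tr(A)`. -/
theorem entropy_flow_gaussian {n : ℕ} (hn : 0 < n)
    (μ : Fin n → ℝ) (V : Matrix (Fin n) (Fin n) ℝ) (hVs : V.IsSymm) (hV : V.PosDef)
    (A : Matrix (Fin n) (Fin n) ℝ) (b : Fin n → ℝ)
    (D : Matrix (Fin n) (Fin n) ℝ) (hD : D.IsDiag) (hDpos : ∀ i, 0 < D i i) :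
    ∑ i, (1 / D i i) *
        ∫ x : Fin n → ℝ,
          gaussianPDF μ V x *
            (((A *ᵥ x + b) i + D i i * (V⁻¹ *ᵥ (x - μ)) i) * (A *ᵥ x + b) i) =
      (A *ᵥ μ + b) ⬝ᵥ (D⁻¹ *ᵥ (A *ᵥ μ + b)) + (Aᵀ * D⁻¹ * A * V).trace + A.trace := by
  obtain ⟨B, hVB, hB⟩ := exists_factor hV
  have hu : IsUnit B.det := isUnit_iff_ne_zero.mpr hB
  have hI : ∀ i, ∫ x : Fin n → ℝ,
          gaussianPDF μ V x *
            (((A *ᵥ x + b) i + D i i * (V⁻¹ *ᵥ (x - μ)) i) * (A *ᵥ x + b) i) =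
      (A *ᵥ μ + b) i * (A *ᵥ μ + b) i + (A * V * Aᵀ) i i + D i i * A i i := by
    intro i
    rw [change_var B hB μ]
    · have e : ∀ y : Fin n → ℝ, |B.det| * (gaussianPDF μ V (B *ᵥ y + μ) *
            (((A *ᵥ (B *ᵥ y + μ) + b) i + D i i * (V⁻¹ *ᵥ (B *ᵥ y + μ - μ)) i) *
              (A *ᵥ (B *ᵥ y + μ) + b) i)) =
          (∏ k, gw (y k)) * (((A *ᵥ μ + b) i + ((A * B) i + D i i • (B⁻¹)ᵀ i) ⬝ᵥ y) *
            ((A *ᵥ μ + b) i + (A * B) i ⬝ᵥ y)) := by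
        intro y
        rw [← mul_assoc, pdf_change hVB hB, add_sub_cancel_right, mulVec_mulVec, inv_B hVB hB,
          mulVec_add, mulVec_mulVec, add_dotProduct, smul_dotProduct]
        simp only [Pi.add_apply, smul_eq_mul]
        have e1 : ((A * B) *ᵥ y) i = (A * B) i ⬝ᵥ y := rfl
        have e2 : ((B⁻¹)ᵀ *ᵥ y) i = (B⁻¹)ᵀ i ⬝ᵥ y := rfl
        rw [e1, e2]
        ring
      simp_rw [e]
      rw [quad, add_dotProduct, smul_dotProduct]
      have e1 : (A * B) i ⬝ᵥ (A * B) i = (A * V * Aᵀ) i i := by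
        rw [hVB, show A * (B * Bᵀ) * Aᵀ = (A * B) * (A * B)ᵀ by
          simp only [transpose_mul, Matrix.mul_assoc]]
        rfl
      have e2 : (B⁻¹)ᵀ i ⬝ᵥ (A * B) i = A i i := by
        have : A * B * B⁻¹ = A := by rw [Matrix.mul_assoc, mul_nonsing_inv _ hu, Matrix.mul_one]
        conv_rhs => rw [← this]
        rw [dotProduct_comm]
        rfl
      rw [e1, e2, smul_eq_mul]
      ring
    · have := gaussianPDF_cont μ V
      simp only [Pi.add_apply, dotProduct, mulVec]
      fun_prop
  simp_rw [hI]
  have hDd : D = diagonal D.diag := hD.diagonal_diag.symm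
  have hDi : D⁻¹ = diagonal fun i => (D i i)⁻¹ := by
    apply inv_eq_right_inv
    have h1 : D * diagonal (fun i => (D i i)⁻¹) =
        diagonal D.diag * diagonal (fun i => (D i i)⁻¹) := by rw [← hDd]
    rw [h1, diagonal_mul_diagonal, ← diagonal_one]
    congr 1
    funext i
    exact mul_inv_cancel₀ (hDpos i).ne'
  have ht : (Aᵀ * D⁻¹ * A * V).trace = ∑ i, (D i i)⁻¹ * (A * V * Aᵀ) i i := by
    rw [Matrix.mul_assoc, Matrix.mul_assoc, trace_mul_comm, Matrix.mul_assoc, hDi]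
    simp [trace, diagonal_mul]
  rw [ht, hDi]
  simp only [dotProduct, mulVec_diagonal, trace, diag_apply, ← Finset.sum_add_distrib]
  refine Finset.sum_congr rfl fun i _ => ?_
  have := (hDpos i).ne'
  field_simp
end

section
/- Let p be the Gaussian density on ℝⁿ with mean μ and covariance Σ, let v ∈ ℝⁿ and let S be a symmetric n×n real matrix. Then ∫_{ℝⁿ} p(x) · ( vᵀΣ⁻¹(x−μ) + (1/2)·((x−μ)ᵀΣ⁻¹SΣ⁻¹(x−μ) − Tr(Σ⁻¹S)) )² dx = vᵀΣ⁻¹v + (1/2)·Tr((Σ⁻¹S)²). -/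
open Matrix MeasureTheory Real

open ProbabilityTheory in
/-- standard normal density -/
noncomputable def stdPhi (t : ℝ) : ℝ := gaussianPDFReal 0 1 t

open ProbabilityTheory in
lemma stdPhi_eq (t : ℝ) : stdPhi t = (Real.sqrt (2 * Real.pi))⁻¹ * Real.exp (-(1/2) * t^2) := by
  simp only [stdPhi, gaussianPDFReal, NNReal.coe_one, mul_one, sub_zero]
  congr 2
  ring

open ProbabilityTheory in
lemma stdPhi_integral : ∫ t, stdPhi t = 1 :=
  integral_gaussianPDFReal_eq_one 0 one_ne_zero

lemma stdPhi_integrable_pow (k : ℕ) : Integrable (fun t : ℝ => t ^ k * stdPhi t) := by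
  have h := integrable_rpow_mul_exp_neg_mul_sq (b := 1/2) (by norm_num) (s := (k:ℝ))
    (by have : (0:ℝ) ≤ k := Nat.cast_nonneg k
        linarith)
  have h2 := h.const_mul (Real.sqrt (2 * Real.pi))⁻¹
  refine h2.congr (Filter.Eventually.of_forall fun t => ?_)
  simp only [stdPhi_eq, Real.rpow_natCast]
  ring

lemma stdPhi_hasDerivAt (t : ℝ) : HasDerivAt stdPhi (-t * stdPhi t) t := by
  have h : stdPhi = fun t => (Real.sqrt (2 * Real.pi))⁻¹ * Real.exp (-(1/2) * t^2) := by
    funext t; exact stdPhi_eq t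
  rw [h]
  have := (((hasDerivAt_pow 2 t).const_mul (-(1/2) : ℝ)).exp).const_mul (Real.sqrt (2 * Real.pi))⁻¹
  refine this.congr_deriv ?_
  push_cast
  ring

lemma stdPhi_moment_one : ∫ t, t * stdPhi t = 0 := by
  have h := integral_eq_zero_of_hasDerivAt_of_integrable (f := stdPhi)
    (f' := fun t => -t * stdPhi t) stdPhi_hasDerivAt
    (by simpa using (stdPhi_integrable_pow 1).neg) (by simpa using (stdPhi_integrable_pow 0))
  simpa [integral_neg] using h

lemma stdPhi_moment_rec (k : ℕ) :
    ∫ t, t ^ (k+2) * stdPhi t = (k + 1) * ∫ t, t ^ k * stdPhi t := by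
  have h := integral_eq_zero_of_hasDerivAt_of_integrable (f := fun t => t ^ (k+1) * stdPhi t)
    (f' := fun t => ((k:ℝ)+1) * (t ^ k * stdPhi t) - t ^ (k+2) * stdPhi t)
    (fun t => by
      refine ((hasDerivAt_pow (k+1) t).mul (stdPhi_hasDerivAt t)).congr_deriv ?_
      push_cast [Nat.add_sub_cancel]
      ring)
    (((stdPhi_integrable_pow k).const_mul _).sub (stdPhi_integrable_pow (k+2)))
    (stdPhi_integrable_pow (k+1))
  rw [integral_sub ((stdPhi_integrable_pow k).const_mul _) (stdPhi_integrable_pow (k+2)),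
    integral_const_mul] at h
  linarith

lemma stdPhi_poly (a b c d e : ℝ) :
    Integrable (fun t => stdPhi t * (a + b*t + c*t^2 + d*t^3 + e*t^4)) ∧
    ∫ t, stdPhi t * (a + b*t + c*t^2 + d*t^3 + e*t^4) = a + c + 3*e := by
  have m0 : ∫ t, t^0 * stdPhi t = 1 := by simpa using stdPhi_integral
  have m1 : ∫ t, t^1 * stdPhi t = 0 := by simpa using stdPhi_moment_one
  have m2 : ∫ t, t^2 * stdPhi t = 1 := by rw [stdPhi_moment_rec 0, m0]; norm_num
  have m3 : ∫ t, t^3 * stdPhi t = 0 := by rw [stdPhi_moment_rec 1, m1]; norm_num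
  have m4 : ∫ t, t^4 * stdPhi t = 3 := by rw [stdPhi_moment_rec 2, m2]; norm_num
  have e0 : (fun t => stdPhi t * (a + b*t + c*t^2 + d*t^3 + e*t^4)) =
    fun t => a * (t^0 * stdPhi t) + b * (t^1 * stdPhi t) + c * (t^2 * stdPhi t)
      + d * (t^3 * stdPhi t) + e * (t^4 * stdPhi t) := by
    funext t; ring
  have i0 := (stdPhi_integrable_pow 0).const_mul a
  have i1 := (stdPhi_integrable_pow 1).const_mul b
  have i2 := (stdPhi_integrable_pow 2).const_mul c
  have i3 := (stdPhi_integrable_pow 3).const_mul d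
  have i4 := (stdPhi_integrable_pow 4).const_mul e
  rw [e0]
  refine ⟨(((i0.add i1).add i2).add i3).add i4, ?_⟩
  have s1 := integral_add i0 i1
  have s2 := integral_add (i0.add i1) i2
  have s3 := integral_add ((i0.add i1).add i2) i3
  have s4 := integral_add (((i0.add i1).add i2).add i3) i4
  simp only [Pi.add_apply] at s1 s2 s3 s4
  rw [s4, s3, s2, s1]
  simp only [integral_const_mul, m0, m1, m2, m3, m4]
  ring

lemma stdPhi_sum_sq {n : ℕ} (w d : Fin n → ℝ) :
    ∫ z : Fin n → ℝ, (∏ k, stdPhi (z k)) * (∑ i, (w i * z i + d i / 2 * ((z i)^2 - 1)))^2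
      = ∑ i, (w i ^ 2 + d i ^ 2 / 2) := by
  set g : Fin n → ℝ → ℝ := fun i t => w i * t + d i / 2 * (t^2 - 1) with hg
  set f : Fin n → Fin n → Fin n → ℝ → ℝ := fun i j k t =>
    stdPhi t * ((if k = i then g i t else 1) * (if k = j then g j t else 1)) with hf
  have hfi : ∀ i j k, Integrable (f i j k) := by
    intro i j k
    simp only [hf, hg]
    split_ifs
    · refine (stdPhi_poly ((d i/2)*(d j/2)) (-(w i * (d j / 2)) - w j * (d i / 2))
        (w i * w j - 2 * (d i/2)*(d j/2)) (w i * (d j / 2) + w j * (d i / 2))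
        ((d i/2)*(d j/2))).1.congr (Filter.Eventually.of_forall fun t => ?_)
      beta_reduce
      ring
    · refine (stdPhi_poly (-(d i/2)) (w i) (d i/2) 0 0).1.congr (Filter.Eventually.of_forall fun t => ?_)
      beta_reduce
      ring
    · refine (stdPhi_poly (-(d j/2)) (w j) (d j/2) 0 0).1.congr (Filter.Eventually.of_forall fun t => ?_)
      beta_reduce
      ring
    · refine (stdPhi_poly 1 0 0 0 0).1.congr (Filter.Eventually.of_forall fun t => ?_)
      beta_reduce
      ring
  have hprod : ∀ i j, Integrable (fun z : Fin n → ℝ => ∏ k, f i j k (z k)) := fun i j =>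
    Integrable.fintype_prod (fun k => hfi i j k)
  have hval : ∀ i j, ∫ z : Fin n → ℝ, ∏ k, f i j k (z k)
      = if i = j then w i ^ 2 + d i ^ 2 / 2 else 0 := by
    intro i j
    rw [integral_fintype_prod_volume_eq_prod]
    split_ifs with hij
    · subst hij
      rw [Finset.prod_eq_single i]
      · simp only [hf, hg, if_true]
        trans (d i/2)*(d i/2) + (w i * w i - 2 * (d i/2)*(d i/2)) + 3 * ((d i/2)*(d i/2))
        · rw [← (stdPhi_poly ((d i/2)*(d i/2)) (-(w i * (d i / 2)) - w i * (d i / 2))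
            (w i * w i - 2 * (d i/2)*(d i/2)) (w i * (d i / 2) + w i * (d i / 2))
            ((d i/2)*(d i/2))).2]
          congr 1; funext t; ring
        · ring
      · intro k _ hk
        simp [hf, hk, stdPhi_integral]
      · simp
    · apply Finset.prod_eq_zero (Finset.mem_univ i)
      simp only [hf, hg, if_true, hij, if_false]
      trans -(d i/2) + (d i/2) + 3 * 0
      · rw [← (stdPhi_poly (-(d i/2)) (w i) (d i/2) 0 0).2]
        congr 1; funext t; ring
      · ring
  have hexp : ∀ z : Fin n → ℝ, (∏ k, stdPhi (z k)) * (∑ i, g i (z i))^2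
      = ∑ i, ∑ j, ∏ k, f i j k (z k) := by
    intro z
    rw [sq, Finset.sum_mul_sum, Finset.mul_sum]
    refine Finset.sum_congr rfl fun i _ => ?_
    rw [Finset.mul_sum]
    refine Finset.sum_congr rfl fun j _ => ?_
    simp only [hf, Finset.prod_mul_distrib, Finset.prod_ite_eq', Finset.mem_univ, if_true]
  calc _ = ∫ z : Fin n → ℝ, ∑ i, ∑ j, ∏ k, f i j k (z k) := by
          congr 1; funext z; exact hexp z
    _ = ∑ i, ∑ j, ∫ z : Fin n → ℝ, ∏ k, f i j k (z k) := by
          rw [integral_finsetSum _ (fun i _ => integrable_finsetSum _ fun j _ => hprod i j)]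
          refine Finset.sum_congr rfl fun i _ => ?_
          rw [integral_finsetSum _ (fun j _ => hprod i j)]
    _ = _ := by simp [hval]

lemma symm_diag {n : ℕ} (T : Matrix (Fin n) (Fin n) ℝ) (hT : T.IsHermitian) :
    ∃ U : Matrix (Fin n) (Fin n) ℝ, U * Uᵀ = 1 ∧ T = U * diagonal hT.eigenvalues * Uᵀ := by
  refine ⟨hT.eigenvectorUnitary, ?_, ?_⟩
  · have := Unitary.coe_mul_star_self hT.eigenvectorUnitary
    simpa [star_eq_conjTranspose] using this
  · have := hT.spectral_theorem
    rw [Unitary.conjStarAlgAut_apply] at this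
    simpa [star_eq_conjTranspose, Function.comp_def] using this

lemma simul_diag {n : ℕ} (V S : Matrix (Fin n) (Fin n) ℝ) (hV : V.PosDef) (hS : S.IsSymm) :
    ∃ (A C : Matrix (Fin n) (Fin n) ℝ) (d : Fin n → ℝ), C * A = 1 ∧ V = A * Aᵀ ∧
      S = A * diagonal d * Aᵀ := by
  obtain ⟨U, hU, hVU⟩ := symm_diag V hV.1
  set l := hV.1.eigenvalues with hl
  have hlpos : ∀ i, 0 < l i := hV.eigenvalues_pos
  set B := U * diagonal (fun i => Real.sqrt (l i)) with hB
  set E := diagonal (fun i => (Real.sqrt (l i))⁻¹) * Uᵀ with hE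
  have hBB : V = B * Bᵀ := by
    rw [hVU, hB, transpose_mul, diagonal_transpose, Matrix.mul_assoc, Matrix.mul_assoc,
      ← Matrix.mul_assoc (diagonal _) (diagonal _), diagonal_mul_diagonal]
    congr 3
    funext i
    exact (Real.mul_self_sqrt (hlpos i).le).symm
  have hBE : B * E = 1 := by
    rw [hB, hE, Matrix.mul_assoc, ← Matrix.mul_assoc (diagonal _) (diagonal _),
      diagonal_mul_diagonal]
    have : (fun i => Real.sqrt (l i) * (Real.sqrt (l i))⁻¹) = fun _ => 1 := by
      funext i
      exact mul_inv_cancel₀ (Real.sqrt_pos.2 (hlpos i)).ne'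
    rw [this, diagonal_one, Matrix.one_mul, hU]
  have hT : (E * S * Eᵀ).IsHermitian := by
    simp only [Matrix.IsHermitian, conjTranspose_eq_transpose_of_trivial, transpose_mul,
      transpose_transpose, hS.eq, Matrix.mul_assoc]
  obtain ⟨W, hW, hTW⟩ := symm_diag _ hT
  have hEB : Eᵀ * Bᵀ = 1 := by rw [← transpose_mul, hBE, transpose_one]
  refine ⟨B * W, Wᵀ * E, hT.eigenvalues, ?_, ?_, ?_⟩
  · rw [Matrix.mul_assoc, ← Matrix.mul_assoc E, mul_eq_one_comm.1 hBE, Matrix.one_mul,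
      mul_eq_one_comm.1 hW]
  · rw [transpose_mul, Matrix.mul_assoc, ← Matrix.mul_assoc W, hW, Matrix.one_mul, hBB]
  · calc S = (B * E) * S * (Eᵀ * Bᵀ) := by rw [hBE, hEB]; simp
      _ = B * (E * S * Eᵀ) * Bᵀ := by simp only [Matrix.mul_assoc]
      _ = B * (W * diagonal hT.eigenvalues * Wᵀ) * Bᵀ := by exact congrArg (fun M => B * M * Bᵀ) hTW
      _ = _ := by rw [transpose_mul B W]; simp only [Matrix.mul_assoc]

lemma integral_affine {n : ℕ} (A : Matrix (Fin n) (Fin n) ℝ) (hA : A.det ≠ 0) (μ : Fin n → ℝ)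
    (F : (Fin n → ℝ) → ℝ) :
    ∫ x, F (x - μ) = |A.det| * ∫ z, F (A *ᵥ z) := by
  rw [integral_sub_right_eq_self F μ]
  have hm := Real.map_matrix_volume_pi_eq_smul_volume_pi hA
  have hemb : MeasurableEmbedding (toLin' A) := by
    have hu : IsUnit A := (Matrix.isUnit_iff_isUnit_det A).2 (isUnit_iff_ne_zero.2 hA)
    have hinj : Function.Injective (toLin' A) := by
      exact Matrix.mulVec_injective_of_isUnit hu
    exact (LinearMap.isClosedEmbedding_of_injective
      (LinearMap.ker_eq_bot.2 hinj)).measurableEmbedding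
  have h := hemb.integral_map (μ := volume) F
  rw [hm, integral_smul_measure, ENNReal.toReal_ofReal (abs_nonneg _)] at h
  simp only [toLin'_apply] at h
  rw [← h, abs_inv, smul_eq_mul, ← mul_assoc, mul_inv_cancel₀ (abs_ne_zero.2 hA), one_mul]

/-- the information rate (time-parametrized Fisher information) of a time-varying
Gaussian: `∫ p·(∂ₜ ln p)² = vᵀΣ⁻¹v + (1/2)·Tr((Σ⁻¹S)²)` where `μ̇ = v`, `Σ̇ = S`. -/
theorem gaussian_information_rate {n : ℕ} (hn : 0 < n) (μ : Fin n → ℝ)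
    (V : Matrix (Fin n) (Fin n) ℝ) (hVs : V.IsSymm) (hV : V.PosDef)
    (v : Fin n → ℝ) (S : Matrix (Fin n) (Fin n) ℝ) (hS : S.IsSymm) :
    ∫ x : Fin n → ℝ,
        gaussianPDF μ V x *
          (v ⬝ᵥ (V⁻¹ *ᵥ (x - μ)) +
            (1 / 2) * ((x - μ) ⬝ᵥ ((V⁻¹ * S * V⁻¹) *ᵥ (x - μ)) - (V⁻¹ * S).trace)) ^ 2 =
      v ⬝ᵥ (V⁻¹ *ᵥ v) + (1 / 2) * ((V⁻¹ * S) ^ 2).trace := by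
  obtain ⟨A, C, d, hCA, hVA, hSA⟩ := simul_diag V S hV hS
  have hAC : A * C = 1 := mul_eq_one_comm.1 hCA
  have hACt : Aᵀ * Cᵀ = 1 := by rw [← transpose_mul, hCA, transpose_one]
  have hCAt : Cᵀ * Aᵀ = 1 := by rw [← transpose_mul, hAC, transpose_one]
  have hdet : A.det ≠ 0 := by
    intro h
    have := congrArg det hAC
    simp [h] at this
  have hVinv : V⁻¹ = Cᵀ * C := by
    apply Matrix.inv_eq_right_inv
    rw [hVA, Matrix.mul_assoc, ← Matrix.mul_assoc Aᵀ, hACt, Matrix.one_mul, hAC]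
  have hVS : V⁻¹ * S = Cᵀ * (diagonal d * Aᵀ) := by
    rw [hVinv, hSA]
    calc _ = Cᵀ * ((C * A) * (diagonal d * Aᵀ)) := by simp only [Matrix.mul_assoc]
      _ = _ := by rw [hCA, Matrix.one_mul]
  have hVSV : V⁻¹ * S * V⁻¹ = Cᵀ * (diagonal d * C) := by
    rw [hVS, hVinv]
    calc _ = Cᵀ * (diagonal d * ((Aᵀ * Cᵀ) * C)) := by simp only [Matrix.mul_assoc]
      _ = _ := by rw [hACt, Matrix.one_mul]
  have htr : (V⁻¹ * S).trace = ∑ i, d i := by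
    rw [hVS, trace_mul_comm, Matrix.mul_assoc, hACt, Matrix.mul_one, trace_diagonal]
  have htr2 : ((V⁻¹ * S) ^ 2).trace = ∑ i, d i ^ 2 := by
    have : (V⁻¹ * S) ^ 2 = Cᵀ * (diagonal d * diagonal d * Aᵀ) := by
      rw [sq, hVS]
      calc _ = Cᵀ * (diagonal d * ((Aᵀ * Cᵀ) * (diagonal d * Aᵀ))) := by
            simp only [Matrix.mul_assoc]
        _ = _ := by rw [hACt, Matrix.one_mul]; simp only [Matrix.mul_assoc]
    rw [this, trace_mul_comm, Matrix.mul_assoc, hACt, Matrix.mul_one, diagonal_mul_diagonal,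
      trace_diagonal]
    simp only [sq]
  have hq : ∀ (a b : Fin n → ℝ) (M : Matrix (Fin n) (Fin n) ℝ),
      a ⬝ᵥ ((Cᵀ * M) *ᵥ b) = (C *ᵥ a) ⬝ᵥ (M *ᵥ b) := by
    intro a b M
    rw [← Matrix.mulVec_mulVec, Matrix.dotProduct_mulVec, Matrix.vecMul_transpose]
  have hCz : ∀ z, C *ᵥ (A *ᵥ z) = z := by
    intro z
    rw [Matrix.mulVec_mulVec, hCA, Matrix.one_mulVec]
  set w := C *ᵥ v with hw
  have hdetV : V.det = A.det ^ 2 := by rw [hVA, det_mul, det_transpose, sq]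
  have hI := integral_affine A hdet μ (fun y => (Real.sqrt ((2 * Real.pi) ^ n * V.det))⁻¹ *
    Real.exp (-(1 / 2) * (y ⬝ᵥ (V⁻¹ *ᵥ y))) * (v ⬝ᵥ (V⁻¹ *ᵥ y) +
            (1 / 2) * (y ⬝ᵥ ((V⁻¹ * S * V⁻¹) *ᵥ y) - (V⁻¹ * S).trace)) ^ 2)
  refine Eq.trans hI ?_
  rw [← integral_const_mul]
  have hsq : Real.sqrt ((2 * Real.pi) ^ n * V.det) = Real.sqrt (2 * Real.pi) ^ n * |A.det| := by
    rw [hdetV, Real.sqrt_mul (by positivity), Real.sqrt_sq_eq_abs]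
    congr 1
    rw [Real.sqrt_eq_iff_mul_self_eq (by positivity) (by positivity), ← mul_pow,
      Real.mul_self_sqrt (by positivity)]
  rw [hVSV, htr, htr2, hsq, hVinv]
  simp only [hq, hCz, ← hw]
  have hstd := stdPhi_sum_sq w d
  trans ∑ i, (w i ^ 2 + d i ^ 2 / 2)
  · rw [← hstd]
    congr 1
    funext z
    have h1 : ∏ k, stdPhi (z k) = (Real.sqrt (2 * Real.pi) ^ n)⁻¹ *
        Real.exp (-(1 / 2) * (z ⬝ᵥ z)) := by
      simp only [stdPhi_eq, Finset.prod_mul_distrib, Finset.prod_const, Finset.card_univ,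
        Fintype.card_fin, ← Real.exp_sum, ← Finset.mul_sum, inv_pow, dotProduct, sq]
    have h2 : w ⬝ᵥ z + 1 / 2 * (z ⬝ᵥ ((diagonal d * C) *ᵥ (A *ᵥ z)) - ∑ i, d i)
        = ∑ i, (w i * z i + d i / 2 * ((z i)^2 - 1)) := by
      rw [← Matrix.mulVec_mulVec, hCz]
      simp only [dotProduct, mulVec_diagonal, ← Finset.sum_sub_distrib, Finset.mul_sum,
        ← Finset.sum_add_distrib]
      refine Finset.sum_congr rfl fun i _ => ?_
      ring
    rw [h2, h1, mul_inv]
    have : |A.det| ≠ 0 := abs_ne_zero.2 hdet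
    field_simp
  · simp only [dotProduct, Finset.mul_sum, ← Finset.sum_add_distrib]
    refine Finset.sum_congr rfl fun i _ => ?_
    ring
end

section
/- Let A be an n×n real matrix, D a diagonal n×n real matrix with positive diagonal entries, Σ a symmetric positive definite n×n real matrix and μ̇ ∈ ℝⁿ, and suppose the matrix AΣ + D is symmetric positive semidefinite. With Σ̇ := AΣ + ΣAᵀ + 2D, Ṡ := Tr(Σ⁻¹D) + Tr(A), Γ² := μ̇ᵀΣ⁻¹μ̇ + (1/2)·Tr((Σ⁻¹Σ̇)²), and Π_u := ‖μ̇‖²·Tr(D⁻¹) + (1/4)·Tr(Σ⁻¹)·Tr(Σ̇)²·Tr(D⁻¹), one has 0 ≤ Γ² ≤ (1/n)·Tr(Σ⁻¹)·Π_u·Tr(D) + Ṡ². -/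
open Matrix

open scoped MatrixOrder in
theorem aux_psd {n : ℕ} {P : Matrix (Fin n) (Fin n) ℝ} (h : P.PosSemidef) :
    ∃ B : Matrix (Fin n) (Fin n) ℝ, P = Bᵀ * B := by
  classical
  obtain ⟨B, hB⟩ := CStarAlgebra.nonneg_iff_eq_star_mul_self.mp h.nonneg
  exact ⟨B, by simpa [conjTranspose_eq_transpose_of_trivial, star_eq_conjTranspose] using hB⟩

theorem aux_tr {n : ℕ} (B C : Matrix (Fin n) (Fin n) ℝ) :
    0 ≤ ((Bᵀ * B) * (Cᵀ * C)).trace ∧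
    ((Bᵀ * B) * (Cᵀ * C)).trace ≤ (Bᵀ * B).trace * (Cᵀ * C).trace := by
  have e1 : ((Bᵀ * B) * (Cᵀ * C)).trace = ∑ i, ∑ j, (∑ k, B i k * C j k) ^ 2 := by
    have : ((Bᵀ * B) * (Cᵀ * C)).trace = ((B * Cᵀ) * (B * Cᵀ)ᵀ).trace := by
      rw [transpose_mul, transpose_transpose, Matrix.mul_assoc, Matrix.trace_mul_comm]
      simp only [Matrix.mul_assoc]
    rw [this]
    simp [Matrix.trace, Matrix.mul_apply, pow_two, mul_comm]
  have e2 : ∀ B : Matrix (Fin n) (Fin n) ℝ, (Bᵀ * B).trace = ∑ i, ∑ k, B i k ^ 2 := by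
    intro B
    rw [Matrix.trace_mul_comm]
    simp [Matrix.trace, Matrix.mul_apply, pow_two]
  rw [e1, e2, e2, Finset.sum_mul_sum]
  refine ⟨by positivity, ?_⟩
  gcongr with i _ j _
  exact Finset.sum_mul_sq_le_sq_mul_sq _ _ _

theorem aux_psd_tr {n : ℕ} {P Q : Matrix (Fin n) (Fin n) ℝ} (hP : P.PosSemidef)
    (hQ : Q.PosSemidef) : 0 ≤ (P * Q).trace ∧ (P * Q).trace ≤ P.trace * Q.trace := by
  obtain ⟨B, rfl⟩ := aux_psd hP
  obtain ⟨C, rfl⟩ := aux_psd hQ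
  exact aux_tr B C

theorem aux_sq {n : ℕ} {P Q : Matrix (Fin n) (Fin n) ℝ} (hP : P.PosSemidef)
    (hQ : Q.PosSemidef) :
    0 ≤ ((P * Q) ^ 2).trace ∧ ((P * Q) ^ 2).trace ≤ (P * Q).trace ^ 2 := by
  obtain ⟨B, rfl⟩ := aux_psd hP
  have hR : (B * Q * Bᵀ).PosSemidef := by
    simpa [conjTranspose_eq_transpose_of_trivial] using hQ.mul_mul_conjTranspose_same B
  have h := aux_psd_tr hR hR
  have e1 : (B * Q * Bᵀ).trace = (Bᵀ * B * Q).trace := by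
    rw [Matrix.trace_mul_comm]; simp only [Matrix.mul_assoc]
  have e2 : ((B * Q * Bᵀ) * (B * Q * Bᵀ)).trace = ((Bᵀ * B * Q) ^ 2).trace := by
    rw [← Matrix.mul_assoc _ _ Bᵀ, Matrix.trace_mul_comm, pow_two]; simp only [Matrix.mul_assoc]
  rw [e1, e2] at h
  rw [pow_two (trace _)]
  exact h

theorem aux_diag {n : ℕ} (D : Matrix (Fin n) (Fin n) ℝ) (hD : D.IsDiag)
    (hDpos : ∀ i, 0 < D i i) : (n : ℝ) ^ 2 ≤ (D⁻¹).trace * D.trace := by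
  have e : D = diagonal (fun i => D i i) := (hD.diagonal_diag).symm
  have hi : D⁻¹ = diagonal (fun i => (D i i)⁻¹) := by
    apply Matrix.inv_eq_right_inv
    conv_lhs => rw [e]
    rw [diagonal_mul_diagonal, ← diagonal_one]
    congr 1
    funext i
    simpa using mul_inv_cancel₀ (hDpos i).ne'
  rw [hi]
  have := Finset.sum_sq_le_sum_mul_sum_of_sq_eq_mul Finset.univ (r := fun _ : Fin n => (1 : ℝ))
    (f := fun i => (D i i)⁻¹) (g := fun i => D i i)
    (fun i _ => (inv_pos.2 (hDpos i)).le) (fun i _ => (hDpos i).le)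
    (fun i _ => by simp [(hDpos i).ne'])
  simpa [Matrix.trace] using this

/-- Relation 3 of the paper: with `Σ̇ = AΣ + ΣAᵀ + 2D`,
`Ṡ = Tr(Σ⁻¹D) + Tr(A)`, `Γ² = μ̇ᵀΣ⁻¹μ̇ + (1/2)Tr((Σ⁻¹Σ̇)²)` and
`Π_u = ‖μ̇‖²·Tr(D⁻¹) + (1/4)·Tr(Σ⁻¹)·Tr(Σ̇)²·Tr(D⁻¹)`, one has
`0 ≤ Γ² ≤ (1/n)·Tr(Σ⁻¹)·Π_u·Tr(D) + Ṡ²`, assuming `AΣ + D` is symmetric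
positive semidefinite. -/
theorem relation_three {n : ℕ} (A : Matrix (Fin n) (Fin n) ℝ)
    (D : Matrix (Fin n) (Fin n) ℝ) (hD : D.IsDiag) (hDpos : ∀ i, 0 < D i i)
    (V : Matrix (Fin n) (Fin n) ℝ) (hVs : V.IsSymm) (hV : V.PosDef)
    (μd : Fin n → ℝ) (hAVD : (A * V + D).PosSemidef) :
    0 ≤ μd ⬝ᵥ (V⁻¹ *ᵥ μd) +
        (1 / 2) * ((V⁻¹ * (A * V + V * Aᵀ + (2 : ℝ) • D)) ^ 2).trace ∧
    μd ⬝ᵥ (V⁻¹ *ᵥ μd) +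
        (1 / 2) * ((V⁻¹ * (A * V + V * Aᵀ + (2 : ℝ) • D)) ^ 2).trace ≤
      (1 / (n : ℝ)) * (V⁻¹).trace *
          (μd ⬝ᵥ μd * (D⁻¹).trace +
            (1 / 4) * (V⁻¹).trace * (A * V + V * Aᵀ + (2 : ℝ) • D).trace ^ 2 * (D⁻¹).trace) *
          D.trace +
        ((V⁻¹ * D).trace + A.trace) ^ 2 := by
  have hdet : IsUnit V.det := hV.det_pos.ne'.isUnit
  have hW : (V⁻¹).PosSemidef := hV.inv.posSemidef
  set M := A * V + D with hM
  have hMs : Mᵀ = M := by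
    simpa [conjTranspose_eq_transpose_of_trivial] using hAVD.isHermitian.eq
  have hDs : Dᵀ = D := hD.isSymm
  have hS : A * V + V * Aᵀ + (2 : ℝ) • D = (2 : ℝ) • M := by
    have : Mᵀ = V * Aᵀ + D := by
      rw [hM, transpose_add, transpose_mul, hVs.eq, hDs]
    rw [two_smul, two_smul]
    nth_rw 2 [← hMs]
    rw [this, hM]
    abel
  have hSd : (V⁻¹ * D).trace + A.trace = (V⁻¹ * M).trace := by
    rw [hM, Matrix.mul_add, trace_add, Matrix.trace_mul_comm V⁻¹ (A * V), Matrix.mul_assoc,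
      Matrix.mul_nonsing_inv _ hdet, Matrix.mul_one, add_comm]
  have hsq : ((V⁻¹ * ((2 : ℝ) • M)) ^ 2).trace = 4 * ((V⁻¹ * M) ^ 2).trace := by
    rw [Matrix.mul_smul, smul_pow, trace_smul]
    norm_num
  rw [hS, hSd, hsq, trace_smul, smul_eq_mul]
  obtain ⟨h1, h2⟩ := aux_sq hW hAVD
  obtain ⟨h3, h4⟩ := aux_psd_tr hW hAVD
  have hU : (vecMulVec μd μd).PosSemidef := by
    simpa using posSemidef_vecMulVec_self_star μd
  obtain ⟨h5, h6⟩ := aux_psd_tr hW hU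
  have e5 : (V⁻¹ * vecMulVec μd μd).trace = μd ⬝ᵥ (V⁻¹ *ᵥ μd) := by
    rw [mul_vecMulVec, trace_vecMulVec, dotProduct_comm]
  rw [e5] at h5 h6
  rw [trace_vecMulVec] at h6
  have hd := aux_diag D hD hDpos
  have hw : 0 ≤ (V⁻¹).trace := hW.trace_nonneg
  have hu : 0 ≤ μd ⬝ᵥ μd := by
    simpa using dotProduct_star_self_nonneg μd
  refine ⟨by positivity, ?_⟩
  rcases Nat.eq_zero_or_pos n with rfl | hn
  · simp [Matrix.trace, dotProduct]
  generalize ((V⁻¹ * M) ^ 2).trace = q at *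
  generalize (V⁻¹ * M).trace = s at *
  generalize μd ⬝ᵥ (V⁻¹ *ᵥ μd) = g at *
  generalize μd ⬝ᵥ μd = u at *
  generalize (V⁻¹).trace = w at *
  generalize M.trace = m at *
  generalize (D⁻¹).trace = d' at *
  generalize D.trace = d at *
  have hn' : (1 : ℝ) ≤ n := by exact_mod_cast hn
  have hk : 1 ≤ (1 / (n : ℝ)) * (d' * d) := by
    rw [one_div, ← div_eq_inv_mul, le_div_iff₀ (by linarith)]
    nlinarith
  have hs : s ^ 2 ≤ (w * m) ^ 2 := pow_le_pow_left₀ h3 h4 2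
  have hX : 0 ≤ w * u + (w * m) ^ 2 := by positivity
  have := mul_le_mul_of_nonneg_right hk hX
  calc g + 1 / 2 * (4 * q) ≤ 1 * (w * u + (w * m) ^ 2) + s ^ 2 := by linarith
    _ ≤ (1 / (n : ℝ)) * (d' * d) * (w * u + (w * m) ^ 2) + s ^ 2 := by linarith
    _ = _ := by ring
end
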